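/- Let q be a prime power, m, n positive integers, α an element of the algebraic closure of 𝔽_q with [𝔽_q(α) : 𝔽_q] = m, β with [𝔽_q(β) : 𝔽_q] = n, and γ an element with γ^{q^{lcm(m,n)}} = γ, say [𝔽_q(γ) : 𝔽_q] = r. Then: for every integer k divisible by gcd(m, lcm(n,r)) there exists an integer t with γ^{q^t} = γ, α^{q^t} = α^{q^k}, and β^{q^t} = β; and conversely, the existence of such t forces gcd(m, lcm(n,r)) to divide k. -/

import Mathlib

open Polynomial

theorem aux_fix {F : Type*} [Field F] [Fintype F] (x : AlgebraicClosure F) (t : ℕ) :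
    x ^ (Fintype.card F) ^ t = x ↔ (minpoly F x).natDegree ∣ t := by
  have hx : IsIntegral F x := Algebra.IsIntegral.isIntegral x
  rw [(minpoly.irreducible hx).natDegree_dvd_iff_dvd_X_pow_card_pow_sub_X, minpoly.dvd_iff,
    Nat.card_eq_fintype_card]
  simp [sub_eq_zero]

theorem aux_le {F : Type*} [Field F] [Fintype F] (x : AlgebraicClosure F) (t k : ℕ)
    (h : t ≤ k) :
    x ^ (Fintype.card F) ^ t = x ^ (Fintype.card F) ^ k ↔
      t ≡ k [MOD (minpoly F x).natDegree] := by
  rw [Nat.modEq_iff_dvd' h, ← aux_fix]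
  obtain ⟨d, rfl⟩ := Nat.exists_eq_add_of_le h
  have hinj : Function.Injective
      (fun y : AlgebraicClosure F => y ^ (Fintype.card F) ^ t) := by
    have := (FiniteField.frobeniusAlgEquivOfAlgebraic F (AlgebraicClosure F)).injective.iterate t
    rwa [FiniteField.coe_frobeniusAlgEquivOfAlgebraic_iterate] at this
  rw [Nat.add_sub_cancel_left, add_comm t d, pow_add, pow_mul]
  exact ⟨fun h => (hinj h).symm, fun h => by rw [h]⟩

theorem aux_iff {F : Type*} [Field F] [Fintype F] (x : AlgebraicClosure F) (t k : ℕ) :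
    x ^ (Fintype.card F) ^ t = x ^ (Fintype.card F) ^ k ↔
      t ≡ k [MOD (minpoly F x).natDegree] := by
  rcases le_total t k with h | h
  · exact aux_le x t k h
  · rw [eq_comm, aux_le x k t h]
    exact ⟨Nat.ModEq.symm, Nat.ModEq.symm⟩

/-- Key step of Theorem `th:g_values`: for `α` of degree `m`, `β` of degree `n` and
`γ ∈ 𝔽_{q^{lcm(m,n)}}` of degree `r` over `𝔽_q`, there is a `t` with `γ^{q^t} = γ`,
`α^{q^t} = α^{q^k}` and `β^{q^t} = β` exactly when `gcd(m, lcm(n,r))` divides `k`. -/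
theorem stmt3 (F : Type*) [Field F] [Fintype F] (q : ℕ) (hq : q = Fintype.card F)
    (m n r : ℕ) (α β γ : AlgebraicClosure F)
    (hα : (minpoly F α).natDegree = m) (hβ : (minpoly F β).natDegree = n)
    (hγmem : γ ^ q ^ Nat.lcm m n = γ) (hγ : (minpoly F γ).natDegree = r) :
    ∀ k : ℕ,
      (∃ t : ℕ, γ ^ q ^ t = γ ∧ α ^ q ^ t = α ^ q ^ k ∧ β ^ q ^ t = β) ↔
        Nat.gcd m (Nat.lcm n r) ∣ k := by
  subst hq hα hβ hγ
  intro k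
  simp only [aux_fix, aux_iff]
  constructor
  · rintro ⟨t, h1, h2, h3⟩
    have h4 := h2.of_dvd (Nat.gcd_dvd_left _ (Nat.lcm (minpoly F β).natDegree
      (minpoly F γ).natDegree))
    exact (h4.dvd_iff dvd_rfl).1 ((Nat.gcd_dvd_right _ _).trans (Nat.lcm_dvd h3 h1))
  · intro h
    obtain ⟨t, h1, h2⟩ := Nat.chineseRemainder' (a := k) (b := 0)
      ((Nat.modEq_zero_iff_dvd).2 h)
    have h3 := (Nat.modEq_zero_iff_dvd).1 h2
    exact ⟨t, (Nat.dvd_lcm_right _ _).trans h3, h1, (Nat.dvd_lcm_left _ _).trans h3⟩
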